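/- With G, C1, C2, α_1, α_2 as in the context (in particular G has no universal vertex), if α_1 + α_2 = 3 and |C_i| ≥ α_i + 1 for i = 1, 2, then G has a 3-tuple dominating set and γ×3(G) = 5. -/

import Mathlib

open Set

/-- The closed neighborhood `N[v]` of a vertex `v`: `v` together with its neighbors. -/
def closedNbhd {V : Type*} (G : SimpleGraph V) (v : V) : Set V :=
  insert v {w | G.Adj v w}

/-- `D` is a `k`-tuple dominating set of `G`: every vertex has at least `k` members of `D`
in its closed neighborhood. -/
def IsKTupleDomSet {V : Type*} (G : SimpleGraph V) (k : ℕ) (D : Set V) : Prop :=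
  ∀ v : V, k ≤ (closedNbhd G v ∩ D).ncard

/-- `γ×k(G)`: the minimum cardinality of a `k`-tuple dominating set of `G`. -/
noncomputable def gammaTuple {V : Type*} (G : SimpleGraph V) (k : ℕ) : ℕ :=
  sInf {n | ∃ D : Set V, IsKTupleDomSet G k D ∧ D.ncard = n}

/-- A vertex is universal if its closed neighborhood is the whole vertex set. -/
def IsUniversalVertex {V : Type*} (G : SimpleGraph V) (u : V) : Prop :=
  closedNbhd G u = Set.univ

/-- The non-neighbor set `N̄(v) = V \ N[v]`. -/
def nonNbhd {V : Type*} (G : SimpleGraph V) (v : V) : Set V :=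
  (closedNbhd G v)ᶜ

/-- `S` is a stable set of the auxiliary interval graph `H_i`: the non-neighbor sets of the
vertices of `S` are pairwise disjoint. -/
def IsC0PStable {V : Type*} (G : SimpleGraph V) (S : Set V) : Prop :=
  S.Pairwise fun u w => Disjoint (nonNbhd G u) (nonNbhd G w)

theorem aux_mem_non {V : Type*} {G : SimpleGraph V} {u v : V} :
    u ∈ nonNbhd G v ↔ u ≠ v ∧ ¬ G.Adj v u := by
  simp [nonNbhd, closedNbhd]

theorem aux_non_symm {V : Type*} {G : SimpleGraph V} {u v : V} (h : u ∈ nonNbhd G v) :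
    v ∈ nonNbhd G u := by
  rw [aux_mem_non] at *
  exact ⟨h.1.symm, fun h' => h.2 h'.symm⟩

theorem aux_non_sub {V : Type*} {G : SimpleGraph V} {C1 C2 : Set V}
    (hunion : C1 ∪ C2 = Set.univ) (hcl1 : G.IsClique C1) {v : V} (hv : v ∈ C1) :
    nonNbhd G v ⊆ C2 := by
  intro u hu
  rw [aux_mem_non] at hu
  have : u ∈ C1 ∪ C2 := by rw [hunion]; trivial
  rcases this with h | h
  · exact absurd (hcl1 hv h hu.1.symm) hu.2
  · exact h

/-- Helly property for the intervals. -/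
theorem aux_helly {V : Type*} [Fintype V] [LinearOrder V] (G : SimpleGraph V) (C1 C2 : Set V)
    (hunion : C1 ∪ C2 = Set.univ) (hne1 : C1.Nonempty)
    (hcl1 : G.IsClique C1)
    (hint1 : ∀ v ∈ C1, (nonNbhd G v).Nonempty ∧
      ∀ a ∈ C2, ∀ b ∈ C2, ∀ c ∈ C2, a ≤ b → b ≤ c →
        a ∈ nonNbhd G v → c ∈ nonNbhd G v → b ∈ nonNbhd G v)
    (h1 : ∀ u ∈ C1, ∀ v ∈ C1, u ≠ v → ¬ Disjoint (nonNbhd G u) (nonNbhd G v)) :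
    ∃ p ∈ C2, C1 ⊆ nonNbhd G p := by
  have hM : ∀ v, ∃ m, v ∈ C1 → m ∈ nonNbhd G v ∧ ∀ x ∈ nonNbhd G v, x ≤ m := by
    intro v
    by_cases hv : v ∈ C1
    · obtain ⟨m, hm, hm'⟩ :=
        Set.exists_max_image (nonNbhd G v) id (Set.toFinite _) (hint1 v hv).1
      exact ⟨m, fun _ => ⟨hm, hm'⟩⟩
    · exact ⟨v, fun h => absurd h hv⟩
  choose M hM using hM
  obtain ⟨v0, hv0, hmin⟩ := Set.exists_min_image C1 M (Set.toFinite _) hne1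
  have hp : M v0 ∈ C2 := aux_non_sub hunion hcl1 hv0 (hM v0 hv0).1
  refine ⟨M v0, hp, fun v hv => aux_non_symm ?_⟩
  by_cases hvv : v = v0
  · subst hvv; exact (hM v hv).1
  · obtain ⟨q, hq1, hq2⟩ := Set.not_disjoint_iff.1 (h1 v hv v0 hv0 hvv)
    exact (hint1 v hv).2 q (aux_non_sub hunion hcl1 hv hq1) _ hp (M v)
      (aux_non_sub hunion hcl1 hv (hM v hv).1) ((hM v0 hv0).2 q hq2) (hmin v hv) hq1 (hM v hv).1

theorem aux_card {V : Type*} [Fintype V] (G : SimpleGraph V) (D : Set V) (v : V) :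
    (closedNbhd G v ∩ D).ncard + (nonNbhd G v ∩ D).ncard = D.ncard := by
  have := Set.ncard_inter_add_ncard_sdiff_eq_ncard D (closedNbhd G v) (Set.toFinite _)
  rwa [Set.inter_comm, Set.sdiff_eq, Set.inter_comm D (closedNbhd G v)ᶜ] at this

theorem aux_main {V : Type*} [Fintype V] [LinearOrder V] (G : SimpleGraph V) (C1 C2 : Set V)
    (hd12 : Disjoint C1 C2) (hunion : C1 ∪ C2 = Set.univ)
    (hne1 : C1.Nonempty)
    (hcl1 : G.IsClique C1) (hcl2 : G.IsClique C2)
    (hint1 : ∀ v ∈ C1, (nonNbhd G v).Nonempty ∧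
      ∀ a ∈ C2, ∀ b ∈ C2, ∀ c ∈ C2, a ≤ b → b ≤ c →
        a ∈ nonNbhd G v → c ∈ nonNbhd G v → b ∈ nonNbhd G v)
    (hα1 : IsGreatest {n | ∃ S : Set V, S ⊆ C1 ∧ IsC0PStable G S ∧ S.ncard = n} 1)
    (hα2 : IsGreatest {n | ∃ S : Set V, S ⊆ C2 ∧ IsC0PStable G S ∧ S.ncard = n} 2)
    (hc1 : 2 ≤ C1.ncard) (hc2 : 3 ≤ C2.ncard) :
    (∃ D : Set V, IsKTupleDomSet G 3 D) ∧ gammaTuple G 3 = 5 := by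
  have h1 : ∀ u ∈ C1, ∀ v ∈ C1, u ≠ v → ¬ Disjoint (nonNbhd G u) (nonNbhd G v) := by
    intro u hu v hv huv hdis
    have : 2 ≤ 1 := hα1.2 ⟨{u, v}, by simp [Set.insert_subset_iff, hu, hv], ?_,
      Set.ncard_pair huv⟩
    · omega
    · intro a ha b hb hab
      rcases ha with rfl | rfl <;> rcases hb with rfl | rfl
      · exact absurd rfl hab
      · exact hdis
      · exact hdis.symm
      · exact absurd rfl hab
  obtain ⟨p, hp, hpC⟩ := aux_helly G C1 C2 hunion hne1 hcl1 hint1 h1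
  have hunion' : C2 ∪ C1 = Set.univ := by rw [Set.union_comm]; exact hunion
  -- upper bound
  obtain ⟨A, hA, hAc⟩ := Set.exists_subset_card_eq hc1
  obtain ⟨S, hS, hSs, hSc⟩ := hα2.1
  obtain ⟨B, hSB, hBC, hBc⟩ :=
    Set.exists_subsuperset_card_eq hS (by omega : S.ncard ≤ 3) hc2
  have hDc : (A ∪ B).ncard = 5 := by
    rw [Set.ncard_union_eq (hd12.mono hA hBC) (Set.toFinite _) (Set.toFinite _), hAc, hBc]
  have hD : IsKTupleDomSet G 3 (A ∪ B) := by
    intro v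
    have hcard := aux_card G (A ∪ B) v
    suffices (nonNbhd G v ∩ (A ∪ B)).ncard ≤ 2 by omega
    have hv : v ∈ C1 ∪ C2 := by rw [hunion]; trivial
    rcases hv with hv | hv
    · by_contra hcon
      have hsub : nonNbhd G v ∩ (A ∪ B) ⊆ B := by
        rintro x ⟨hx, hxA | hxB⟩
        · exact absurd (aux_non_sub hunion hcl1 hv hx) (Set.disjoint_left.1 hd12 (hA hxA))
        · exact hxB
      have heq := Set.eq_of_subset_of_ncard_le hsub (by omega) (Set.toFinite _)
      obtain ⟨x, y, hxy, hSe⟩ := Set.ncard_eq_two.1 hSc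
      have hx : x ∈ S := by simp [hSe]
      have hy : y ∈ S := by simp [hSe]
      have hx' := hSB hx
      have hy' := hSB hy
      rw [← heq] at hx' hy'
      exact Set.disjoint_left.1 (hSs hx hy hxy) (aux_non_symm hx'.1) (aux_non_symm hy'.1)
    · have hsub : nonNbhd G v ∩ (A ∪ B) ⊆ A := by
        rintro x ⟨hx, hxA | hxB⟩
        · exact hxA
        · exact absurd (hBC hxB) (Set.disjoint_left.1 hd12 (aux_non_sub hunion' hcl2 hv hx))
      exact hAc ▸ Set.ncard_le_ncard hsub (Set.toFinite _)
  refine ⟨⟨_, hD⟩, le_antisymm (Nat.sInf_le ⟨_, hD, hDc⟩) ?_⟩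
  refine le_csInf ⟨5, _, hD, hDc⟩ ?_
  rintro n ⟨E, hE, rfl⟩
  by_contra hlt
  have hstab : IsC0PStable G (E ∩ C2) := by
    intro x hx y hy hxy
    rw [Set.disjoint_left]
    intro v hvx hvy
    have h2 : ({x, y} : Set V) ⊆ nonNbhd G v ∩ E := by
      rintro z (rfl | rfl)
      · exact ⟨aux_non_symm hvx, hx.1⟩
      · exact ⟨aux_non_symm hvy, hy.1⟩
    have h3 := Set.ncard_le_ncard h2 (Set.toFinite _)
    rw [Set.ncard_pair hxy] at h3
    have := aux_card G E v
    have := hE v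
    omega
  have hle : (E ∩ C2).ncard ≤ 2 := hα2.2 ⟨_, Set.inter_subset_right, hstab, rfl⟩
  have hge : (closedNbhd G p ∩ E).ncard ≤ (E ∩ C2).ncard := by
    apply Set.ncard_le_ncard _ (Set.toFinite _)
    rintro x ⟨hx, hxE⟩
    refine ⟨hxE, ?_⟩
    have hx' : x ∈ C1 ∪ C2 := by rw [hunion]; trivial
    exact hx'.resolve_left fun h => hpC h hx
  have := hE p
  omega

theorem aux_pos {V : Type*} [Fintype V] (G : SimpleGraph V) (C : Set V) (hne : C.Nonempty) (α : ℕ)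
    (hα : IsGreatest {n | ∃ S : Set V, S ⊆ C ∧ IsC0PStable G S ∧ S.ncard = n} α) : 1 ≤ α := by
  obtain ⟨c, hc⟩ := hne
  exact hα.2 ⟨{c}, by simpa using hc, Set.pairwise_singleton _ _, Set.ncard_singleton _⟩

/-- in a C0P-graph with no universal vertices, if `α1 + α2 = 3` and `|C_i| ≥ α_i + 1` for `i = 1, 2`, then `G` has a `3`-tuple dominating set and `γ×3(G) = 5`. -/
theorem stmt15 {V : Type*} [Fintype V] [LinearOrder V] (G : SimpleGraph V) (C1 C2 : Set V)
    (hd12 : Disjoint C1 C2) (hunion : C1 ∪ C2 = Set.univ)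
    (hne1 : C1.Nonempty) (hne2 : C2.Nonempty)
    (hcl1 : G.IsClique C1) (hcl2 : G.IsClique C2)
    (hnouniv : ∀ v : V, ¬ IsUniversalVertex G v)
    (hint1 : ∀ v ∈ C1, (nonNbhd G v).Nonempty ∧
      ∀ a ∈ C2, ∀ b ∈ C2, ∀ c ∈ C2, a ≤ b → b ≤ c →
        a ∈ nonNbhd G v → c ∈ nonNbhd G v → b ∈ nonNbhd G v)
    (hint2 : ∀ v ∈ C2, (nonNbhd G v).Nonempty ∧
      ∀ a ∈ C1, ∀ b ∈ C1, ∀ c ∈ C1, a ≤ b → b ≤ c →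
        a ∈ nonNbhd G v → c ∈ nonNbhd G v → b ∈ nonNbhd G v)
    (α1 α2 : ℕ)
    (hα1 : IsGreatest {n | ∃ S : Set V, S ⊆ C1 ∧ IsC0PStable G S ∧ S.ncard = n} α1)
    (hα2 : IsGreatest {n | ∃ S : Set V, S ⊆ C2 ∧ IsC0PStable G S ∧ S.ncard = n} α2)
    (h : α1 + α2 = 3) (hc1 : α1 + 1 ≤ C1.ncard) (hc2 : α2 + 1 ≤ C2.ncard) :
    (∃ D : Set V, IsKTupleDomSet G 3 D) ∧ gammaTuple G 3 = 5 := by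
  have p1 := aux_pos G C1 hne1 α1 hα1
  have p2 := aux_pos G C2 hne2 α2 hα2
  have hcase : (α1 = 1 ∧ α2 = 2) ∨ (α1 = 2 ∧ α2 = 1) := by omega
  rcases hcase with ⟨rfl, rfl⟩ | ⟨rfl, rfl⟩
  · exact aux_main G C1 C2 hd12 hunion hne1 hcl1 hcl2 hint1 hα1 hα2 hc1 hc2
  · exact aux_main G C2 C1 hd12.symm (by rw [Set.union_comm]; exact hunion) hne2 hcl2 hcl1 hint2
      hα2 hα1 hc2 hc1
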